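/- (Theorem 3, finite-dimensional core.) Let Q be a transition rate matrix on m states (Q(i,j) ≥ 0 for i ≠ j, rows summing to zero), and let π_∞ ∈ ℝ^m be entrywise positive with Σ_i (π_∞)_i = 1 and satisfying the detailed balance condition (π_∞)_i Q(i,j) = (π_∞)_j Q(j,i) for all i, j. Let p⁺ be a point of the probability simplex Δ^{m-1} with all entries strictly positive. Then there exists λ₀ > 0 such that for all λ ∈ (0, λ₀): (i) I − λQ is invertible; (ii) the row vector p⁻ := p⁺(I − λQ)^{-1} lies in Δ^{m-1} and has all entries strictly positive; and (iii) p⁻ is the unique minimizer over Δ^{m-1} of the functional p ↦ (1/2)‖p − p⁺‖²_{π_∞} + λΦ⁻(p), where ‖v‖²_{π_∞} := Σ_{i=1}^m v_i²/(π_∞)_i and Φ⁻(p) := −(1/2) Σ_{i=1}^m (pQ)_i p_i/(π_∞)_i. -/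

import Mathlib

open Matrix Finset

lemma form_eq {m : ℕ} (Q : Matrix (Fin m) (Fin m) ℝ) (w u v : Fin m → ℝ) :
    ∑ i, (u ᵥ* Q) i * v i / w i = ∑ i, ∑ j, u j * Q j i * v i / w i := by
  refine Finset.sum_congr rfl fun i _ => ?_
  simp only [Matrix.vecMul, dotProduct, Finset.sum_mul, Finset.sum_div]

lemma form_symm {m : ℕ} (Q : Matrix (Fin m) (Fin m) ℝ) (w : Fin m → ℝ) (hw : ∀ i, 0 < w i)
    (hdb : ∀ i j, w i * Q i j = w j * Q j i) (u v : Fin m → ℝ) :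
    ∑ i, (u ᵥ* Q) i * v i / w i = ∑ i, (v ᵥ* Q) i * u i / w i := by
  rw [form_eq, form_eq, Finset.sum_comm]
  refine Finset.sum_congr rfl fun i _ => Finset.sum_congr rfl fun j _ => ?_
  have h1 := (hw i).ne'
  have h2 := (hw j).ne'
  have h := hdb i j
  rw [div_eq_div_iff h2 h1]
  linear_combination u i * v j * h

lemma form_nonpos {m : ℕ} (Q : Matrix (Fin m) (Fin m) ℝ)
    (hoff : ∀ i j, i ≠ j → 0 ≤ Q i j) (hrow : ∀ i, ∑ j, Q i j = 0)
    (w : Fin m → ℝ) (hw : ∀ i, 0 < w i)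
    (hdb : ∀ i j, w i * Q i j = w j * Q j i) (v : Fin m → ℝ) :
    ∑ i, (v ᵥ* Q) i * v i / w i ≤ 0 := by
  have key : ∑ i, ∑ j, w i * Q i j * (v i / w i - v j / w j) ^ 2
      = - 2 * ∑ i, (v ᵥ* Q) i * v i / w i := by
    have hA : ∑ i, ∑ j, w i * Q i j * (v i / w i) ^ 2 = 0 := by
      refine Finset.sum_eq_zero fun i _ => ?_
      rw [← Finset.sum_mul, ← Finset.mul_sum, hrow]; simp
    have hB : ∑ i, ∑ j, w i * Q i j * (v j / w j) ^ 2 = 0 := by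
      rw [Finset.sum_comm, ← hA]
      refine Finset.sum_congr rfl fun i _ => Finset.sum_congr rfl fun j _ => ?_
      rw [hdb]
    have hC : ∑ i, ∑ j, w i * Q i j * ((v i / w i) * (v j / w j))
        = ∑ i, (v ᵥ* Q) i * v i / w i := by
      rw [form_eq]
      refine Finset.sum_congr rfl fun i _ => Finset.sum_congr rfl fun j _ => ?_
      rw [hdb]
      have h1 := (hw i).ne'
      have h2 := (hw j).ne'
      field_simp
    rw [← hC]
    calc _ = ∑ i, ∑ j, (w i * Q i j * (v i / w i) ^ 2 + w i * Q i j * (v j / w j) ^ 2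
          - 2 * (w i * Q i j * ((v i / w i) * (v j / w j)))) := by
          refine Finset.sum_congr rfl fun i _ => Finset.sum_congr rfl fun j _ => ?_
          ring
      _ = _ := by
          simp only [Finset.sum_sub_distrib, Finset.sum_add_distrib, ← Finset.mul_sum]
          rw [hA, hB]; ring
  have hpos : 0 ≤ ∑ i, ∑ j, w i * Q i j * (v i / w i - v j / w j) ^ 2 := by
    refine Finset.sum_nonneg fun i _ => Finset.sum_nonneg fun j _ => ?_
    by_cases h : i = j
    · subst h; simp
    · exact mul_nonneg (mul_nonneg (hw i).le (hoff i j h)) (sq_nonneg _)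
  linarith

lemma sq_form_pos {m : ℕ} (w : Fin m → ℝ) (hw : ∀ i, 0 < w i) (v : Fin m → ℝ) (hv : v ≠ 0) :
    0 < ∑ i, v i ^ 2 / w i := by
  obtain ⟨k, hk⟩ := Function.ne_iff.mp hv
  refine Finset.sum_pos' (fun i _ => div_nonneg (sq_nonneg _) (hw i).le) ⟨k, Finset.mem_univ _, ?_⟩
  have : v k ≠ 0 := by simpa using hk
  have := hw k
  positivity

/-- Finite-dimensional core of Theorem 3: for a reversible transition rate
matrix `Q` with stationary distribution `π_∞` and an entrywise-positive
`p⁺ ∈ Δ^{m−1}`, for all sufficiently small `λ > 0` the vector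
`p⁻ = p⁺(I − λQ)⁻¹` lies in the simplex, is entrywise positive, and is the
unique minimizer over the simplex of `p ↦ (1/2)‖p − p⁺‖²_{π_∞} + λΦ⁻(p)`. -/
theorem prior_prox_recursion
    (m : ℕ) (Q : Matrix (Fin m) (Fin m) ℝ)
    (hoff : ∀ i j, i ≠ j → 0 ≤ Q i j)
    (hrow : ∀ i, ∑ j, Q i j = 0)
    (w : Fin m → ℝ) (hw : ∀ i, 0 < w i) (hwsum : ∑ i, w i = 1)
    (hdb : ∀ i j, w i * Q i j = w j * Q j i)
    (pplus : Fin m → ℝ) (hp : ∀ i, 0 < pplus i) (hpsum : ∑ i, pplus i = 1) :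
    ∃ lam₀ > (0 : ℝ), ∀ lam : ℝ, 0 < lam → lam < lam₀ →
      IsUnit ((1 : Matrix (Fin m) (Fin m) ℝ) - lam • Q) ∧
      (∀ i, 0 < (pplus ᵥ* ((1 : Matrix (Fin m) (Fin m) ℝ) - lam • Q)⁻¹) i) ∧
      (∑ i, (pplus ᵥ* ((1 : Matrix (Fin m) (Fin m) ℝ) - lam • Q)⁻¹) i = 1) ∧
      (∀ p : Fin m → ℝ, (∀ i, 0 ≤ p i) → (∑ i, p i = 1) →
        p ≠ pplus ᵥ* ((1 : Matrix (Fin m) (Fin m) ℝ) - lam • Q)⁻¹ →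
        (1/2) * ∑ i,
            ((pplus ᵥ* ((1 : Matrix (Fin m) (Fin m) ℝ) - lam • Q)⁻¹) i - pplus i)^2 / w i
          - (lam/2) * ∑ i,
            ((pplus ᵥ* ((1 : Matrix (Fin m) (Fin m) ℝ) - lam • Q)⁻¹) ᵥ* Q) i *
              (pplus ᵥ* ((1 : Matrix (Fin m) (Fin m) ℝ) - lam • Q)⁻¹) i / w i
        < (1/2) * ∑ i, (p i - pplus i)^2 / w i
          - (lam/2) * ∑ i, (p ᵥ* Q) i * p i / w i) := by
  refine ⟨1, one_pos, fun lam hl _ => ?_⟩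
  have hU : IsUnit ((1 : Matrix (Fin m) (Fin m) ℝ) - lam • Q) := by
    rw [← Matrix.vecMul_injective_iff_isUnit]
    rw [injective_iff_map_eq_zero (Matrix.vecMulLinear ((1 : Matrix (Fin m) (Fin m) ℝ) - lam • Q))
      |> fun h => (show Function.Injective (fun v => v ᵥ* ((1 : Matrix (Fin m) (Fin m) ℝ) - lam • Q)) ↔ _ from h)]
    intro v hv
    by_contra hne
    have h1 := sq_form_pos w hw v hne
    have h2 := form_nonpos Q hoff hrow w hw hdb v
    have h3 : ∀ i, v i = lam * (v ᵥ* Q) i := by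
      intro i
      have := congrFun hv i
      simp [Matrix.vecMul_sub, Matrix.vecMul_smul] at this
      linarith
    have h4 : ∑ i, v i ^ 2 / w i = lam * ∑ i, (v ᵥ* Q) i * v i / w i := by
      rw [Finset.mul_sum]
      refine Finset.sum_congr rfl fun i _ => ?_
      rw [sq]
      nth_rewrite 1 [h3 i]
      ring
    nlinarith
  refine ⟨hU, ?_⟩
  set q := pplus ᵥ* ((1 : Matrix (Fin m) (Fin m) ℝ) - lam • Q)⁻¹ with hq
  have hqe : q ᵥ* ((1 : Matrix (Fin m) (Fin m) ℝ) - lam • Q) = pplus := by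
    rw [hq, Matrix.vecMul_vecMul, Matrix.nonsing_inv_mul _ ((Matrix.isUnit_iff_isUnit_det _).mp hU),
      Matrix.vecMul_one]
  have hqi : ∀ i, q i - lam * (q ᵥ* Q) i = pplus i := by
    intro i
    have := congrFun hqe i
    simpa [Matrix.vecMul_sub, Matrix.vecMul_smul] using this
  clear_value q
  refine ⟨?_, ?_, ?_⟩
  · intro i
    haveI : Nonempty (Fin m) := ⟨i⟩
    obtain ⟨k, hk⟩ := Finite.exists_min (fun j => q j / w j)
    have hs : 0 ≤ (q ᵥ* Q) k := by
      have e : (q ᵥ* Q) k = w k * ∑ j, Q k j * (q j / w j - q k / w k) := by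
        simp only [mul_sub, Finset.sum_sub_distrib, ← Finset.sum_mul, hrow]
        simp only [Matrix.vecMul, dotProduct, zero_mul, mul_zero, sub_zero, Finset.mul_sum]
        refine Finset.sum_congr rfl fun j _ => ?_
        rw [← mul_assoc, hdb]
        have := (hw j).ne'
        field_simp
      rw [e]
      refine mul_nonneg (hw k).le (Finset.sum_nonneg fun j _ => ?_)
      by_cases h : k = j
      · subst h; simp
      · exact mul_nonneg (hoff k j h) (sub_nonneg.mpr (hk j))
    have hqk : 0 < q k := by
      have := hqi k
      have := hp k
      have := mul_nonneg hl.le hs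
      linarith
    have h1 : 0 < q i / w i := lt_of_lt_of_le (div_pos hqk (hw k)) (hk i)
    have h2 := mul_pos h1 (hw i)
    rwa [div_mul_cancel₀ _ (hw i).ne'] at h2
  · have h0 : ∑ i, (q ᵥ* Q) i = 0 := by
      simp only [Matrix.vecMul, dotProduct]
      rw [Finset.sum_comm]
      simp [← Finset.mul_sum, hrow]
    rw [← hpsum, ← Finset.sum_congr rfl (fun i _ => hqi i), Finset.sum_sub_distrib,
      ← Finset.mul_sum, h0]
    simp
  · intro p _ _ hne
    have hd : p - q ≠ 0 := sub_ne_zero.mpr hne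
    have h1 := sq_form_pos w hw _ hd
    have h2 := form_nonpos Q hoff hrow w hw hdb (p - q)
    have h3 := form_symm Q w hw hdb p q
    have e1 : ∑ i, ((p - q) ᵥ* Q) i * (p - q) i / w i
        = ∑ i, (p ᵥ* Q) i * p i / w i - ∑ i, (p ᵥ* Q) i * q i / w i
          - ∑ i, (q ᵥ* Q) i * p i / w i + ∑ i, (q ᵥ* Q) i * q i / w i := by
      rw [← Finset.sum_sub_distrib, ← Finset.sum_sub_distrib, ← Finset.sum_add_distrib]
      refine Finset.sum_congr rfl fun i _ => ?_
      simp only [Matrix.sub_vecMul, Pi.sub_apply]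
      ring
    have e2 : ∑ i, (p i - pplus i) ^ 2 / w i = ∑ i, (p - q) i ^ 2 / w i
        + ∑ i, (q i - pplus i) ^ 2 / w i
        + 2 * lam * (∑ i, (q ᵥ* Q) i * p i / w i - ∑ i, (q ᵥ* Q) i * q i / w i) := by
      rw [← Finset.sum_sub_distrib, Finset.mul_sum, ← Finset.sum_add_distrib,
        ← Finset.sum_add_distrib]
      refine Finset.sum_congr rfl fun i _ => ?_
      rw [← hqi i]
      simp only [Pi.sub_apply]
      ring
    rw [e2]
    have h4 := mul_nonneg hl.le (neg_nonneg.mpr h2)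
    rw [e1] at h4
    rw [h3] at h4
    linarith
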